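/- arXiv:1111.5899 — 4 statements merged into one kernel-verified Lean document; each statement's English description precedes it below -/
import Mathlib

section
/- Let S ⊂ V(G) be a subset of vertices such that every vertex v in the vertex boundary bS is adjacent to at least K₀ = K₀(S) ≥ 1 vertices of S, and suppose S ∪ bS = V(G). Then for every f ∈ L₂(G) one has ‖f‖ ≤ (Σ_{u∈S} (2·d₀(u)/K₀ + 1)·|f(u)|²)^{1/2} + (2/√K₀)·‖L^{1/2} f‖. -/
open scoped BigOperators

variable {V : Type*}

noncomputable def lapl (G : SimpleGraph V) [DecidableRel G.Adj] [G.LocallyFinite]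
    (f : V → ℂ) (v : V) : ℂ :=
  ∑ u ∈ G.neighborFinset v, (f v - f u)

noncomputable def l2norm (f : V → ℂ) : ℝ :=
  Real.sqrt (∑' v, ‖f v‖ ^ 2)

noncomputable def dirichlet (G : SimpleGraph V) [DecidableRel G.Adj] [G.LocallyFinite]
    (f : V → ℂ) : ℝ :=
  (∑' v, lapl G f v * (starRingEnd ℂ) (f v)).re

def bdry (G : SimpleGraph V) (S : Set V) : Set V :=
  {v | v ∉ S ∧ ∃ u ∈ S, G.Adj u v}

noncomputable def d0 (G : SimpleGraph V) (S : Set V) (u : V) : ℕ :=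
  {w | w ∈ bdry G S ∧ G.Adj u w}.ncard

theorem hasSum_ite_mem_const {s : Set V} [DecidablePred (· ∈ s)] (hs : s.Finite) (c : ℝ) :
    HasSum (fun u => if u ∈ s then c else 0) (s.ncard * c) := by
  have h := hasSum_sum_of_ne_finset_zero (f := fun u => if u ∈ s then c else 0)
    (s := hs.toFinset) (L := .unconditional V)
    (fun u hu => if_neg (by simpa using hu))
  rw [Finset.sum_congr rfl (fun u hu => if_pos (hs.mem_toFinset.1 hu)), Finset.sum_const,
    nsmul_eq_mul, ← Set.ncard_eq_toFinset_card s hs] at h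
  exact h

theorem finite_setOf_of_le_adj (G : SimpleGraph V) [G.LocallyFinite] {R : V → V → Prop}
    (hR : ∀ v u, R v u → G.Adj v u) (v : V) : {u | R v u}.Finite :=
  (G.neighborSet v).toFinite.subset fun u hu => hR v u hu

theorem ncard_setOf_le_degree (G : SimpleGraph V) [G.LocallyFinite] {R : V → V → Prop}
    (hR : ∀ v u, R v u → G.Adj v u) (v : V) : {u | R v u}.ncard ≤ G.degree v := by
  have h := Set.ncard_le_ncard (s := {u | R v u}) (t := G.neighborSet v)
    (fun u hu => hR v u hu) (Set.toFinite _)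
  rwa [Set.ncard_eq_toFinset_card' (G.neighborSet v), ← SimpleGraph.neighborFinset_def,
    SimpleGraph.card_neighborFinset_eq_degree] at h

theorem summable_ncard_mul (G : SimpleGraph V) [G.LocallyFinite] {D : ℕ}
    (hD : ∀ v, G.degree v ≤ D) {R : V → V → Prop} (hR : ∀ v u, R v u → G.Adj v u)
    {g : V → ℝ} (hg : ∀ v, 0 ≤ g v) (hgs : Summable g) :
    Summable fun v => ({u | R v u}.ncard : ℝ) * g v := by
  refine Summable.of_nonneg_of_le (fun v => mul_nonneg (Nat.cast_nonneg _) (hg v)) (fun v => ?_)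
    (hgs.mul_left (D : ℝ))
  have h : ({u | R v u}.ncard : ℝ) ≤ D := by
    exact_mod_cast (ncard_setOf_le_degree G hR v).trans (hD v)
  exact mul_le_mul_of_nonneg_right h (hg v)

theorem hasSum_ite_rel_fst (G : SimpleGraph V) [G.LocallyFinite] {D : ℕ}
    (hD : ∀ v, G.degree v ≤ D) {R : V → V → Prop} [DecidableRel R]
    (hR : ∀ v u, R v u → G.Adj v u)
    {g : V → ℝ} (hg : ∀ v, 0 ≤ g v) (hgs : Summable g) :
    HasSum (fun p : V × V => if R p.1 p.2 then g p.1 else 0)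
      (∑' v, ({u | R v u}.ncard : ℝ) * g v) := by
  have hfib : ∀ v, HasSum (fun u => if R v u then g v else 0) ({u | R v u}.ncard * g v) :=
    fun v => hasSum_ite_mem_const (finite_setOf_of_le_adj G hR v) (g v)
  have hsum : Summable (fun p : V × V => if R p.1 p.2 then g p.1 else 0) := by
    refine (summable_prod_of_nonneg fun p => ?_).2 ⟨fun v => (hfib v).summable, ?_⟩
    · dsimp only [Pi.zero_apply]
      split_ifs
      exacts [hg _, le_rfl]
    · simpa only [(hfib _).tsum_eq] using summable_ncard_mul G hD hR hg hgs
  convert hsum.hasSum using 1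
  rw [hsum.tsum_prod]
  exact tsum_congr fun v => (hfib v).tsum_eq.symm

theorem hasSum_ite_rel_snd (G : SimpleGraph V) [G.LocallyFinite] {D : ℕ}
    (hD : ∀ v, G.degree v ≤ D) {R : V → V → Prop} [DecidableRel R]
    (hR : ∀ v u, R v u → G.Adj v u)
    {g : V → ℝ} (hg : ∀ v, 0 ≤ g v) (hgs : Summable g) :
    HasSum (fun p : V × V => if R p.1 p.2 then g p.2 else 0)
      (∑' u, ({v | R v u}.ncard : ℝ) * g u) :=
  (Equiv.prodComm V V).hasSum_iff.1
    (hasSum_ite_rel_fst G hD (R := fun u v => R v u) (fun u v h => (hR v u h).symm) hg hgs)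

theorem norm_sub_sq_le_two_mul (a b : ℂ) : ‖a - b‖ ^ 2 ≤ 2 * ‖a‖ ^ 2 + 2 * ‖b‖ ^ 2 := by
  have h := norm_sub_le a b
  nlinarith [norm_nonneg (a - b), norm_nonneg a, norm_nonneg b, sq_nonneg (‖a‖ - ‖b‖)]

theorem norm_sq_le_two_mul_add_norm_sub_sq (a b : ℂ) :
    ‖a‖ ^ 2 ≤ 2 * ‖b‖ ^ 2 + 2 * ‖a - b‖ ^ 2 := by
  have h := norm_sub_sq_le_two_mul b (b - a)
  rwa [sub_sub_cancel, norm_sub_rev b a] at h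

theorem summable_ite_adj_norm_sub_sq (G : SimpleGraph V) [G.LocallyFinite] {D : ℕ}
    (hD : ∀ v, G.degree v ≤ D) {R : V → V → Prop} [DecidableRel R]
    (hR : ∀ v u, R v u → G.Adj v u)
    {f : V → ℂ} (hf : Summable fun v => ‖f v‖ ^ 2) :
    Summable fun p : V × V => if R p.1 p.2 then ‖f p.1 - f p.2‖ ^ 2 else 0 := by
  have h1 := (hasSum_ite_rel_fst G hD hR (fun v => sq_nonneg ‖f v‖) hf).summable
  have h2 := (hasSum_ite_rel_snd G hD hR (fun v => sq_nonneg ‖f v‖) hf).summable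
  refine Summable.of_nonneg_of_le (fun p => ?_) (fun p => ?_)
    ((h1.mul_left 2).add (h2.mul_left 2))
  · split_ifs <;> positivity
  · split_ifs
    · exact norm_sub_sq_le_two_mul _ _
    · simp

/-- The Dirichlet form is half the sum of `‖f v - f u‖ ^ 2` over ordered adjacent pairs. -/
theorem two_mul_dirichlet (G : SimpleGraph V) [DecidableRel G.Adj] [G.LocallyFinite] {D : ℕ}
    (hD : ∀ v, G.degree v ≤ D) {f : V → ℂ} (hf : Summable fun v => ‖f v‖ ^ 2) :
    2 * dirichlet G f = ∑' p : V × V, if G.Adj p.1 p.2 then ‖f p.1 - f p.2‖ ^ 2 else 0 := by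
  set Z : V × V → ℂ := fun p =>
    if G.Adj p.1 p.2 then (f p.1 - f p.2) * (starRingEnd ℂ) (f p.1) else 0 with hZ
  have hZs : Summable Z := by
    have h1 := (hasSum_ite_rel_fst G hD (R := G.Adj) (fun _ _ h => h)
      (fun v => sq_nonneg ‖f v‖) hf).summable
    have h2 := summable_ite_adj_norm_sub_sq G hD (R := G.Adj) (fun _ _ h => h) hf
    refine Summable.of_norm_bounded (h1.add h2) fun p => ?_
    simp only [hZ]
    split_ifs
    · rw [norm_mul, RCLike.norm_conj]
      nlinarith [sq_nonneg (‖f p.1‖ - ‖f p.1 - f p.2‖), sq_nonneg ‖f p.1‖,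
        sq_nonneg ‖f p.1 - f p.2‖]
    · simp
  have hE : dirichlet G f = ∑' p, (Z p).re := by
    rw [dirichlet, ← Complex.re_tsum hZs, hZs.tsum_prod]
    congr 1
    refine tsum_congr fun v => ?_
    rw [lapl, Finset.sum_mul, tsum_eq_sum (s := G.neighborFinset v)]
    · refine Finset.sum_congr rfl fun u hu => ?_
      exact (if_pos ((G.mem_neighborFinset v u).1 hu)).symm
    · intro u hu
      exact if_neg (fun h => hu ((G.mem_neighborFinset v u).2 h))
  have hre : Summable fun p => (Z p).re := (Complex.hasSum_re hZs.hasSum).summable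
  have hswap : ∑' p : V × V, (Z p.swap).re = ∑' p, (Z p).re :=
    (Equiv.prodComm V V).tsum_eq fun p => (Z p).re
  have hres : Summable fun p : V × V => (Z p.swap).re := (Equiv.prodComm V V).summable_iff.2 hre
  rw [two_mul, hE]
  nth_rewrite 2 [← hswap]
  rw [← hre.tsum_add hres]
  refine tsum_congr fun p => ?_
  simp only [hZ, Prod.fst_swap, Prod.snd_swap, G.adj_comm p.2 p.1]
  split_ifs
  · rw [← Complex.normSq_eq_norm_sq, Complex.normSq_apply]
    simp
    ring
  · simp

theorem tsum_cut_norm_sub_sq_le_dirichlet (G : SimpleGraph V) [DecidableRel G.Adj]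
    [G.LocallyFinite] {D : ℕ} (hD : ∀ v, G.degree v ≤ D) {R : V → V → Prop} [DecidableRel R]
    (hR : ∀ v u, R v u → G.Adj v u) (hasymm : ∀ v u, R v u → ¬ R u v)
    {f : V → ℂ} (hf : Summable fun v => ‖f v‖ ^ 2) :
    (∑' p : V × V, if R p.1 p.2 then ‖f p.1 - f p.2‖ ^ 2 else 0) ≤ dirichlet G f := by
  set W : V × V → ℝ := fun p => if R p.1 p.2 then ‖f p.1 - f p.2‖ ^ 2 else 0 with hW
  have hWs : Summable W := summable_ite_adj_norm_sub_sq G hD hR hf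
  have hswap : ∑' p : V × V, W p.swap = ∑' p, W p := (Equiv.prodComm V V).tsum_eq W
  have hWs' : Summable fun p : V × V => W p.swap := (Equiv.prodComm V V).summable_iff.2 hWs
  have h : ∑' p, (W p + W p.swap) ≤ 2 * dirichlet G f := by
    rw [two_mul_dirichlet G hD hf]
    refine (hWs.add hWs').tsum_le_tsum (fun p => ?_)
      (summable_ite_adj_norm_sub_sq G hD (R := G.Adj) (fun _ _ h => h) hf)
    simp only [hW, Prod.fst_swap, Prod.snd_swap]
    by_cases h1 : R p.1 p.2
    · simp [h1, hasymm _ _ h1, hR _ _ h1]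
    · by_cases h2 : R p.2 p.1
      · simp [h1, h2, (hR _ _ h2).symm, norm_sub_rev]
      · simp only [h1, h2, if_false, add_zero]
        split_ifs <;> positivity
  rw [hWs.tsum_add hWs', hswap] at h
  linarith

theorem mul_tsum_boundary_le (G : SimpleGraph V) [DecidableRel G.Adj] [G.LocallyFinite] {D : ℕ}
    (hD : ∀ v, G.degree v ≤ D) (S : Set V) (K₀ : ℕ)
    (hKS : ∀ v ∈ bdry G S, K₀ ≤ {u | u ∈ S ∧ G.Adj v u}.ncard)
    {f : V → ℂ} (hf : Summable fun v => ‖f v‖ ^ 2) :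
    K₀ * ∑' v, (bdry G S).indicator (fun v => ‖f v‖ ^ 2) v ≤
      2 * ∑' u, S.indicator (fun u => (d0 G S u : ℝ) * ‖f u‖ ^ 2) u + 2 * dirichlet G f := by
  classical
  set R : V → V → Prop := fun v u => v ∈ bdry G S ∧ u ∈ S ∧ G.Adj v u with hRdef
  have hR : ∀ v u, R v u → G.Adj v u := fun v u h => h.2.2
  have hasymm : ∀ v u, R v u → ¬ R u v := fun v u h h' => h.1.1 h'.2.1
  have hg : ∀ v, 0 ≤ ‖f v‖ ^ 2 := fun v => sq_nonneg _
  have h1 := hasSum_ite_rel_fst G hD hR hg hf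
  have h2 := hasSum_ite_rel_snd G hD hR hg hf
  have h3 := summable_ite_adj_norm_sub_sq G hD hR hf
  have hlow : K₀ * ∑' v, (bdry G S).indicator (fun v => ‖f v‖ ^ 2) v ≤
      ∑' v, ({u | R v u}.ncard : ℝ) * ‖f v‖ ^ 2 := by
    rw [← tsum_mul_left]
    refine ((hf.indicator _).mul_left _).tsum_le_tsum (fun v => ?_)
      (summable_ncard_mul G hD hR hg hf)
    by_cases hv : v ∈ bdry G S
    · rw [Set.indicator_of_mem hv]
      have : {u | R v u} = {u | u ∈ S ∧ G.Adj v u} := by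
        ext u
        simp [hRdef, hv]
      rw [this]
      exact mul_le_mul_of_nonneg_right (by exact_mod_cast hKS v hv) (hg v)
    · rw [Set.indicator_of_notMem hv, mul_zero]
      exact mul_nonneg (Nat.cast_nonneg _) (hg v)
  have hdeg : ∑' u, ({v | R v u}.ncard : ℝ) * ‖f u‖ ^ 2 =
      ∑' u, S.indicator (fun u => (d0 G S u : ℝ) * ‖f u‖ ^ 2) u := by
    refine tsum_congr fun u => ?_
    by_cases hu : u ∈ S
    · simp [hRdef, hu, d0, G.adj_comm u]
    · simp [hRdef, hu]
  have hmid : ∑' v, ({u | R v u}.ncard : ℝ) * ‖f v‖ ^ 2 ≤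
      2 * ∑' u, ({v | R v u}.ncard : ℝ) * ‖f u‖ ^ 2 +
      2 * ∑' p : V × V, if R p.1 p.2 then ‖f p.1 - f p.2‖ ^ 2 else 0 := by
    refine hasSum_le (fun p => ?_) h1 ((h2.mul_left 2).add (h3.hasSum.mul_left 2))
    split_ifs
    · exact norm_sq_le_two_mul_add_norm_sub_sq _ _
    · simp
  have hcut := tsum_cut_norm_sub_sq_le_dirichlet G hD hR hasymm hf
  rw [hdeg] at hmid
  linarith

theorem stmt0 [Countable V] (G : SimpleGraph V) [DecidableRel G.Adj] [G.LocallyFinite]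
    (hconn : G.Connected) (D : ℕ) (hD : ∀ v, G.degree v ≤ D)
    (S : Set V) (K₀ : ℕ) (hK : 1 ≤ K₀)
    (hKS : ∀ v ∈ bdry G S, K₀ ≤ {u | u ∈ S ∧ G.Adj v u}.ncard)
    (hcover : S ∪ bdry G S = Set.univ)
    (f : V → ℂ) (hf : Memℓp f 2) :
    l2norm f ≤ Real.sqrt (∑' u : S, (2 * (d0 G S u : ℝ) / (K₀ : ℝ) + 1) * ‖f u‖ ^ 2)
      + (2 / Real.sqrt (K₀ : ℝ)) * Real.sqrt (dirichlet G f) := by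
  have hs : Summable fun v => ‖f v‖ ^ 2 := by
    have h := (memℓp_gen_iff (by norm_num)).1 hf
    simpa using h
  have hg : ∀ v, 0 ≤ ‖f v‖ ^ 2 := fun v => sq_nonneg _
  have hKpos : (0 : ℝ) < K₀ := by exact_mod_cast hK
  set A := ∑' u : S, (2 * (d0 G S u : ℝ) / (K₀ : ℝ) + 1) * ‖f u‖ ^ 2 with hA
  have hA0 : 0 ≤ A := tsum_nonneg fun u => by positivity
  have hd0 : Summable fun u => (d0 G S u : ℝ) * ‖f u‖ ^ 2 :=
    summable_ncard_mul G hD (R := fun u w => w ∈ bdry G S ∧ G.Adj u w) (fun _ _ h => h.2) hg hs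
  have hAeq : A = 2 / K₀ * ∑' u, S.indicator (fun u => (d0 G S u : ℝ) * ‖f u‖ ^ 2) u +
      ∑' u, S.indicator (fun v => ‖f v‖ ^ 2) u := by
    rw [hA, tsum_subtype S fun u => (2 * (d0 G S u : ℝ) / (K₀ : ℝ) + 1) * ‖f u‖ ^ 2,
      ← tsum_mul_left, ← ((hd0.indicator S).mul_left _).tsum_add (hs.indicator S)]
    refine tsum_congr fun u => ?_
    by_cases hu : u ∈ S
    · simp only [Set.indicator_of_mem hu]
      ring
    · simp [hu]
  have hsplit : ∑' v, ‖f v‖ ^ 2 = ∑' v, S.indicator (fun v => ‖f v‖ ^ 2) v +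
      ∑' v, (bdry G S).indicator (fun v => ‖f v‖ ^ 2) v := by
    rw [← (hs.indicator S).tsum_add (hs.indicator _)]
    refine tsum_congr fun v => ?_
    by_cases hv : v ∈ S
    · have : v ∉ bdry G S := fun h => h.1 hv
      simp [hv, this]
    · have : v ∈ bdry G S := ((Set.ext_iff.1 hcover v).2 trivial).resolve_left hv
      simp [hv, this]
  have hE0 : 0 ≤ dirichlet G f := by
    have h : 0 ≤ 2 * dirichlet G f := by
      rw [two_mul_dirichlet G hD hs]
      exact tsum_nonneg fun p => by split_ifs <;> positivity
    linarith
  have hbd := mul_tsum_boundary_le G hD S K₀ hKS hs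
  have hmain : ∑' v, ‖f v‖ ^ 2 ≤ A + 2 / K₀ * dirichlet G f := by
    rw [hsplit, hAeq]
    have : ∑' v, (bdry G S).indicator (fun v => ‖f v‖ ^ 2) v ≤
        (2 * ∑' u, S.indicator (fun u => (d0 G S u : ℝ) * ‖f u‖ ^ 2) u +
          2 * dirichlet G f) / K₀ := by
      rw [le_div_iff₀ hKpos]
      linarith
    rw [add_div, mul_div_right_comm, mul_div_right_comm] at this
    linarith
  refine Real.sqrt_le_iff.2 ⟨by positivity, hmain.trans ?_⟩
  rw [add_sq, Real.sq_sqrt hA0, mul_pow, div_pow, Real.sq_sqrt hKpos.le, Real.sq_sqrt hE0]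
  have h1 : 0 ≤ 2 * √A * (2 / √(K₀ : ℝ) * √(dirichlet G f)) := by positivity
  have h2 : 2 / (K₀ : ℝ) * dirichlet G f ≤ 2 ^ 2 / K₀ * dirichlet G f := by
    gcongr
    norm_num
  linarith
end

section
/- Let S ⊂ V(G) be a subset of vertices such that every vertex v in the vertex boundary bS is adjacent to at least K₀ = K₀(S) ≥ 1 vertices of S. Then for every f ∈ L₂(G) one has (Σ_{v∈cl(S)} |f(v)|²)^{1/2} ≤ (Σ_{u∈S} (2·d₀(u)/K₀ + 1)·|f(u)|²)^{1/2} + (2/√K₀)·‖L^{1/2} f‖, where cl(S) = S ∪ bS. -/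
open scoped BigOperators

variable {V : Type*}

def cl (G : SimpleGraph V) (S : Set V) : Set V := S ∪ bdry G S

/-- A function on ordered pairs vanishing off adjacent pairs sums over a row as a finite sum. -/
theorem tsum_ite_adj {E : Type*} [AddCommMonoid E] [TopologicalSpace E] (G : SimpleGraph V)
    [DecidableRel G.Adj] [G.LocallyFinite] (v : V) (g : V → E) :
    ∑' u, (if G.Adj v u then g u else 0) = ∑ u ∈ G.neighborFinset v, g u := by
  rw [tsum_eq_sum (s := G.neighborFinset v)]
  · refine Finset.sum_congr rfl fun u hu => ?_
    rw [if_pos ((G.mem_neighborFinset v u).1 hu)]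
  · intro u hu
    rw [if_neg fun h => hu ((G.mem_neighborFinset v u).2 h)]

/-- In a graph of bounded degree, a summable weight on vertices is summable over darts. -/
theorem summable_adj_fst (G : SimpleGraph V) [DecidableRel G.Adj]
    [G.LocallyFinite] {D : ℕ}
    (hD : ∀ v, G.degree v ≤ D) {a : V → ℝ} (ha : Summable a) (h0 : ∀ v, 0 ≤ a v) :
    Summable fun p : V × V => if G.Adj p.1 p.2 then a p.1 else 0 := by
  rw [summable_prod_of_nonneg fun p => by
    change (0 : ℝ) ≤ if G.Adj p.1 p.2 then a p.1 else 0
    split_ifs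
    exacts [h0 _, le_rfl]]
  refine ⟨fun v => ?_, ?_⟩
  · refine summable_of_ne_finset_zero (s := G.neighborFinset v) fun u hu => ?_
    exact if_neg fun h => hu ((G.mem_neighborFinset v u).2 h)
  · refine Summable.of_nonneg_of_le (fun v => tsum_nonneg fun u => ?_) (fun v => ?_)
      (ha.mul_left (D : ℝ))
    · dsimp only
      split_ifs
      exacts [h0 _, le_rfl]
    · dsimp only
      rw [tsum_ite_adj G v fun _ => a v, Finset.sum_const, nsmul_eq_mul]
      exact mul_le_mul_of_nonneg_right (by exact_mod_cast hD v) (h0 v)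

/-- The squared differences along darts are summable for a square-summable function. -/
theorem summable_adj_sq_sub (G : SimpleGraph V) [DecidableRel G.Adj]
    [G.LocallyFinite] {D : ℕ}
    (hD : ∀ v, G.degree v ≤ D) {f : V → ℂ} (hf : Summable fun v => ‖f v‖ ^ 2) :
    Summable fun p : V × V => if G.Adj p.1 p.2 then ‖f p.1 - f p.2‖ ^ 2 else 0 := by
  have h1 := summable_adj_fst G hD hf fun v => sq_nonneg _
  have h2 := (Equiv.prodComm V V).summable_iff.2 h1
  refine Summable.of_nonneg_of_le (fun p => ?_) (fun p => ?_) ((h1.add h2).mul_left 2)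
  · split_ifs <;> positivity
  · simp only [Function.comp, Equiv.prodComm_apply, Prod.fst_swap, Prod.snd_swap,
      G.adj_comm p.2 p.1]
    split_ifs
    · nlinarith [norm_sub_le (f p.1) (f p.2), norm_nonneg (f p.1 - f p.2),
        sq_nonneg (‖f p.1‖ - ‖f p.2‖)]
    · simp

open Classical in
/-- Sum over darts from `S` to its boundary of a weight on the initial vertex. -/
theorem tsum_boundary_dart_fst (G : SimpleGraph V) [DecidableRel G.Adj]
    [G.LocallyFinite] (S : Set V) (a : V → ℝ)
    (u : V) :
    ∑' v, (if G.Adj u v then (if u ∈ S ∧ v ∈ bdry G S then a u else 0) else 0) =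
      S.indicator (fun u => (d0 G S u : ℝ) * a u) u := by
  rw [tsum_ite_adj G u fun v => if u ∈ S ∧ v ∈ bdry G S then a u else 0]
  by_cases hu : u ∈ S
  · have hset : {w | w ∈ bdry G S ∧ G.Adj u w} =
        ((G.neighborFinset u).filter (· ∈ bdry G S) : Set V) := by
      ext w
      simp [and_comm]
    rw [Set.indicator_of_mem hu, d0, hset, Set.ncard_coe_finset]
    simp [hu, ← Finset.sum_filter]
  · simp [hu]

open Classical in
/-- If every boundary vertex has at least `K` neighbours in `S`, the `ℓ²` mass of the boundary
is controlled by the mass of `S` and the Dirichlet form. -/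
theorem tsum_bdry_le (G : SimpleGraph V) [DecidableRel G.Adj] [G.LocallyFinite] {D : ℕ}
    (hD : ∀ v, G.degree v ≤ D) (S : Set V) (K : ℕ)
    (hKS : ∀ v ∈ bdry G S, K ≤ {u | u ∈ S ∧ G.Adj v u}.ncard)
    {f : V → ℂ} (hf : Summable fun v => ‖f v‖ ^ 2) :
    (K : ℝ) * ∑' v, (bdry G S).indicator (fun v => ‖f v‖ ^ 2) v ≤
      2 * ∑' u, S.indicator (fun u => (d0 G S u : ℝ) * ‖f u‖ ^ 2) u + 2 * dirichlet G f := by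
  set A : V × V → ℝ := fun p => if G.Adj p.1 p.2 then
    (if p.1 ∈ S ∧ p.2 ∈ bdry G S then ‖f p.1‖ ^ 2 else 0) else 0 with hA
  set B : V × V → ℝ := fun p => if G.Adj p.1 p.2 then
    (if p.1 ∈ S ∧ p.2 ∈ bdry G S then ‖f p.1 - f p.2‖ ^ 2 else 0) else 0 with hB
  have hN := summable_adj_sq_sub G hD hf
  have hAs : Summable A := by
    refine Summable.of_nonneg_of_le (fun p => ?_) (fun p => ?_)
      (summable_adj_fst G hD hf fun v => sq_nonneg _)
    · simp only [hA]; split_ifs <;> positivity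
    · simp only [hA]; split_ifs <;> first | exact le_rfl | positivity
  have hBs : Summable B := by
    refine Summable.of_nonneg_of_le (fun p => ?_) (fun p => ?_) hN
    · simp only [hB]; split_ifs <;> positivity
    · simp only [hB]; split_ifs <;> first | exact le_rfl | positivity
  have hBsw : Summable fun p => B (Prod.swap p) := (Equiv.prodComm V V).summable_iff.2 hBs
  have hAsum : ∑' p, A p = ∑' u, S.indicator (fun u => (d0 G S u : ℝ) * ‖f u‖ ^ 2) u := by
    rw [hAs.tsum_prod]
    exact tsum_congr fun u => tsum_boundary_dart_fst G S (fun u => ‖f u‖ ^ 2) u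
  have hBsum : ∑' p, B p ≤ dirichlet G f := by
    have hsw : ∑' p, B (Prod.swap p) = ∑' p, B p := (Equiv.prodComm V V).tsum_eq B
    have hle : ∑' p, (B p + B (Prod.swap p)) ≤
        ∑' p : V × V, if G.Adj p.1 p.2 then ‖f p.1 - f p.2‖ ^ 2 else 0 := by
      refine (hBs.add hBsw).tsum_le_tsum (fun p => ?_) hN
      simp only [hB, Prod.fst_swap, Prod.snd_swap, G.adj_comm p.2 p.1, norm_sub_rev (f p.2)]
      split_ifs with h1 h2 h3 h3
      · exact absurd h2.1 h3.2.1
      · simp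
      · simp
      · simp
      · simp
    rw [hBs.tsum_add hBsw, hsw, ← two_mul_dirichlet G hD hf] at hle
    linarith
  have hC : Summable fun p : V × V => 2 * A p.swap + 2 * B p.swap :=
    (((Equiv.prodComm V V).summable_iff.2 hAs).mul_left 2).add (hBsw.mul_left 2)
  have hCsum : ∑' p : V × V, (2 * A p.swap + 2 * B p.swap) = 2 * ∑' p, A p + 2 * ∑' p, B p := by
    rw [← tsum_mul_left, ← tsum_mul_left, ← (hAs.mul_left 2).tsum_add (hBs.mul_left 2)]
    exact (Equiv.prodComm V V).tsum_eq fun p => 2 * A p + 2 * B p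
  have hrow : ∀ v, (K : ℝ) * (bdry G S).indicator (fun v => ‖f v‖ ^ 2) v ≤
      ∑' u, (2 * A (u, v) + 2 * B (u, v)) := by
    intro v
    by_cases hv : v ∈ bdry G S
    · have hset : {u | u ∈ S ∧ G.Adj v u} = ((G.neighborFinset v).filter (· ∈ S) : Set V) := by
        ext w
        simp [and_comm]
      have hcard : (K : ℝ) ≤ ((G.neighborFinset v).filter (· ∈ S)).card := by
        have := hKS v hv
        rw [hset, Set.ncard_coe_finset] at this
        exact_mod_cast this
      have hsum : ∑' u, (2 * A (u, v) + 2 * B (u, v)) = ∑' u, if G.Adj v u then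
          (if u ∈ S then 2 * ‖f u‖ ^ 2 + 2 * ‖f u - f v‖ ^ 2 else 0) else 0 := by
        refine tsum_congr fun u => ?_
        simp only [hA, hB, hv, and_true, G.adj_comm u v]
        split_ifs <;> simp
      rw [hsum, tsum_ite_adj G v
        fun u => if u ∈ S then 2 * ‖f u‖ ^ 2 + 2 * ‖f u - f v‖ ^ 2 else 0,
        ← Finset.sum_filter, Set.indicator_of_mem hv]
      refine (mul_le_mul_of_nonneg_right hcard (sq_nonneg _)).trans ?_
      rw [← nsmul_eq_mul]
      refine Finset.card_nsmul_le_sum _ _ _ fun u _ => ?_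
      have := norm_sub_le (f u) (f u - f v)
      rw [sub_sub_cancel] at this
      nlinarith [norm_nonneg (f v), sq_nonneg (‖f u‖ - ‖f u - f v‖)]
    · simp [hA, hB, hv]
  calc (K : ℝ) * ∑' v, (bdry G S).indicator (fun v => ‖f v‖ ^ 2) v
      = ∑' v, (K : ℝ) * (bdry G S).indicator (fun v => ‖f v‖ ^ 2) v := tsum_mul_left.symm
    _ ≤ ∑' v, ∑' u, (2 * A (u, v) + 2 * B (u, v)) :=
        ((hf.indicator _).mul_left _).tsum_le_tsum hrow hC.prod
    _ = 2 * ∑' p, A p + 2 * ∑' p, B p := by rw [← hCsum, hC.tsum_prod]; rfl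
    _ ≤ _ := by rw [hAsum]; linarith

/-- The number of boundary neighbours of a vertex is at most its degree. -/
theorem d0_le_degree (G : SimpleGraph V) [G.LocallyFinite] (S : Set V) (u : V) :
    d0 G S u ≤ G.degree u := by
  rw [d0, ← G.card_neighborFinset_eq_degree, ← Set.ncard_coe_finset]
  refine Set.ncard_le_ncard (fun w hw => ?_) (Finset.finite_toSet _)
  simpa using hw.2

theorem stmt2 [Countable V] (G : SimpleGraph V) [DecidableRel G.Adj] [G.LocallyFinite]
    (hconn : G.Connected) (D : ℕ) (hD : ∀ v, G.degree v ≤ D)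
    (S : Set V) (K₀ : ℕ) (hK : 1 ≤ K₀)
    (hKS : ∀ v ∈ bdry G S, K₀ ≤ {u | u ∈ S ∧ G.Adj v u}.ncard)
    (f : V → ℂ) (hf : Memℓp f 2) :
    Real.sqrt (∑' v : cl G S, ‖f v‖ ^ 2) ≤
      Real.sqrt (∑' u : S, (2 * (d0 G S u : ℝ) / (K₀ : ℝ) + 1) * ‖f u‖ ^ 2)
      + (2 / Real.sqrt (K₀ : ℝ)) * Real.sqrt (dirichlet G f) := by
  have hs : Summable fun v => ‖f v‖ ^ 2 := by
    simpa using (memℓp_gen_iff (p := 2) (by simp)).1 hf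
  have hKpos : (0 : ℝ) < K₀ := by exact_mod_cast hK
  have hb := tsum_bdry_le G hD S K₀ hKS hs
  have hd : Summable fun u => (d0 G S u : ℝ) * ‖f u‖ ^ 2 := by
    refine Summable.of_nonneg_of_le (fun u => by positivity) (fun u => ?_) (hs.mul_left (D : ℝ))
    refine mul_le_mul_of_nonneg_right ?_ (sq_nonneg _)
    exact_mod_cast (d0_le_degree G S u).trans (hD u)
  have hE : 0 ≤ dirichlet G f := by
    have h2 := two_mul_dirichlet G hD hs
    have : 0 ≤ 2 * dirichlet G f := by
      rw [h2]
      refine tsum_nonneg fun p => ?_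
      split_ifs <;> positivity
    linarith
  have hcl : ∑' v : cl G S, ‖f v‖ ^ 2 =
      ∑' v : S, ‖f v‖ ^ 2 + ∑' v, (bdry G S).indicator (fun v => ‖f v‖ ^ 2) v := by
    have hdisj : Disjoint S (bdry G S) := Set.disjoint_left.2 fun v hv hv' => hv'.1 hv
    rw [← tsum_subtype (bdry G S)]
    exact (hs.subtype S).tsum_union_disjoint (f := fun v => ‖f v‖ ^ 2) hdisj
      (hs.subtype (bdry G S))
  have hT : ∑' u : S, (2 * (d0 G S u : ℝ) / (K₀ : ℝ) + 1) * ‖f u‖ ^ 2 =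
      2 / K₀ * ∑' u, S.indicator (fun u => (d0 G S u : ℝ) * ‖f u‖ ^ 2) u
        + ∑' v : S, ‖f v‖ ^ 2 := by
    rw [← tsum_subtype S, ← tsum_mul_left]
    have hd' : Summable fun u : S => 2 / (K₀ : ℝ) * ((d0 G S u : ℝ) * ‖f u‖ ^ 2) :=
      (hd.subtype S).mul_left _
    have hs' : Summable fun u : S => ‖f u‖ ^ 2 := hs.subtype S
    rw [← hd'.tsum_add hs']
    exact tsum_congr fun u => by ring
  have hmain : ∑' v : cl G S, ‖f v‖ ^ 2 ≤
      ∑' u : S, (2 * (d0 G S u : ℝ) / (K₀ : ℝ) + 1) * ‖f u‖ ^ 2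
        + 4 / K₀ * dirichlet G f := by
    rw [hcl, hT]
    have h1 := (le_div_iff₀' hKpos).2 hb
    have h2 : 0 ≤ dirichlet G f / K₀ := by positivity
    have h3 : ∀ x : ℝ, (2 * x + 2 * dirichlet G f) / K₀ =
        2 / K₀ * x + 4 / K₀ * dirichlet G f - 2 * (dirichlet G f / K₀) := fun x => by ring
    rw [h3] at h1
    linarith
  have hT0 : 0 ≤ ∑' u : S, (2 * (d0 G S u : ℝ) / (K₀ : ℝ) + 1) * ‖f u‖ ^ 2 :=
    tsum_nonneg fun u => by positivity
  refine Real.sqrt_le_iff.2 ⟨by positivity, hmain.trans ?_⟩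
  rw [add_sq, mul_pow, div_pow, Real.sq_sqrt hT0, Real.sq_sqrt hE, Real.sq_sqrt hKpos.le]
  have : 0 ≤ 2 * √(∑' u : S, (2 * (d0 G S u : ℝ) / (K₀ : ℝ) + 1) * ‖f u‖ ^ 2) *
      (2 / √(K₀ : ℝ) * √(dirichlet G f)) := by positivity
  linarith
end

section
/- Let H be a complex Hilbert space and T a bounded, self-adjoint, nonnegative operator on H. If for some positive constants a > 0, c > 0 and a vector φ ∈ H the inequality ‖φ‖ ≤ a + c·‖Tφ‖ holds, then for every l ∈ ℕ, setting r = 2^l, one has ‖φ‖ ≤ 2r·a + 8^{r−1}·c^r·‖T^r φ‖. -/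
open scoped InnerProductSpace

section SelfAdjoint

variable {H : Type*} [NormedAddCommGroup H] [InnerProductSpace ℂ H] [CompleteSpace H]

/-- A self-adjoint operator satisfies `‖S x‖² ≤ ‖S² x‖ ‖x‖`. -/
lemma IsSelfAdjoint.sq_norm_apply_le {S : H →L[ℂ] H} (hS : IsSelfAdjoint S) (x : H) :
    ‖S x‖ ^ 2 ≤ ‖(S ^ 2) x‖ * ‖x‖ := by
  have hsymm : ⟪S (S x), x⟫_ℂ = ⟪S x, S x⟫_ℂ := hS.isSymmetric (S x) x
  have hcs := norm_inner_le_norm (𝕜 := ℂ) (S (S x)) x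
  rw [hsymm, inner_self_eq_norm_sq_to_K] at hcs
  simpa [pow_two] using hcs

/-- A bound of `‖x‖` through `‖S x‖` self-improves to one through `‖S² x‖`. -/
lemma IsSelfAdjoint.norm_le_two_mul_add_sq_mul {S : H →L[ℂ] H} (hS : IsSelfAdjoint S) {x : H}
    {a c : ℝ} (h : ‖x‖ ≤ a + c * ‖S x‖) :
    ‖x‖ ≤ 2 * a + c ^ 2 * ‖(S ^ 2) x‖ := by
  have hsq : (c * ‖S x‖) ^ 2 ≤ c ^ 2 * ‖(S ^ 2) x‖ * ‖x‖ := by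
    rw [mul_pow, mul_assoc]
    exact mul_le_mul_of_nonneg_left (hS.sq_norm_apply_le x) (sq_nonneg c)
  have hamgm : c * ‖S x‖ ≤ (c ^ 2 * ‖(S ^ 2) x‖ + ‖x‖) / 2 := by
    refine le_of_abs_le (abs_le_of_sq_le_sq ?_ (by positivity))
    nlinarith [sq_nonneg (c ^ 2 * ‖(S ^ 2) x‖ - ‖x‖)]
  linarith

/-- Iterating the self-improvement `l` times gives a bound through `‖T ^ (2 ^ l) x‖`. -/
lemma IsSelfAdjoint.norm_le_two_pow_mul_add_pow_mul {T : H →L[ℂ] H} (hT : IsSelfAdjoint T) {x : H}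
    {a c : ℝ} (h : ‖x‖ ≤ a + c * ‖T x‖) (l : ℕ) :
    ‖x‖ ≤ 2 ^ l * a + c ^ 2 ^ l * ‖(T ^ 2 ^ l) x‖ := by
  induction l with
  | zero => simpa using h
  | succ l ih =>
    have := (hT.pow (2 ^ l)).norm_le_two_mul_add_sq_mul ih
    rwa [← pow_mul, ← pow_mul, ← pow_succ, ← mul_assoc, ← pow_succ'] at this

end SelfAdjoint

theorem stmt5 {H : Type*} [NormedAddCommGroup H] [InnerProductSpace ℂ H] [CompleteSpace H]
    (T : H →L[ℂ] H) (hsa : IsSelfAdjoint T)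
    (hpos : ∀ x : H, 0 ≤ (⟪T x, x⟫_ℂ).re)
    (a c : ℝ) (ha : 0 < a) (hc : 0 < c) (φ : H)
    (h : ‖φ‖ ≤ a + c * ‖T φ‖) (l : ℕ) :
    ‖φ‖ ≤ 2 * (2 ^ l : ℝ) * a + 8 ^ (2 ^ l - 1 : ℕ) * c ^ (2 ^ l : ℕ) * ‖(T ^ (2 ^ l : ℕ)) φ‖ := by
  refine (hsa.norm_le_two_pow_mul_add_pow_mul h l).trans ?_
  gcongr
  · exact le_mul_of_one_le_left (by positivity) one_le_two
  · exact le_mul_of_one_le_left (by positivity) (one_le_pow₀ (by norm_num))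
end

section
/- Let S ⊂ V(G) be a subset of vertices such that every vertex v in bS is adjacent to at least K₀ ≥ 1 vertices of S and S ∪ bS = V(G). If 0 < ω < K₀/4, then S is a uniqueness set for PW_ω(L): if f, g ∈ PW_ω(L) satisfy f(u) = g(u) for all u ∈ S, then f = g. -/
open scoped BigOperators

variable {V : Type*}

/-- The Paley–Wiener space `PW_ω(L)`: all `f ∈ L₂(G)` satisfying the Bernstein
inequality `‖L^k f‖ ≤ ω^k ‖f‖` for all `k ∈ ℕ`. -/
noncomputable def PW (G : SimpleGraph V) [DecidableRel G.Adj] [G.LocallyFinite] (ω : ℝ) :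
    Set (V → ℂ) :=
  {f | Memℓp f 2 ∧ ∀ k : ℕ, l2norm ((lapl G)^[k] f) ≤ ω ^ k * l2norm f}

open scoped ComplexConjugate InnerProductSpace

/-- The oriented edges of `G`, grouped by their initial vertex. -/
abbrev OrientedEdge (G : SimpleGraph V) : Type _ := (v : V) × G.neighborSet v

/-- Reversal of oriented edges. -/
def OrientedEdge.swap (G : SimpleGraph V) : OrientedEdge G ≃ OrientedEdge G where
  toFun p := ⟨p.2.1, p.1, p.2.2.symm⟩
  invFun p := ⟨p.2.1, p.1, p.2.2.symm⟩
  left_inv _ := rfl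
  right_inv _ := rfl

theorem tsum_orientedEdge (G : SimpleGraph V) [DecidableRel G.Adj] [G.LocallyFinite]
    {E : Type*} [NormedAddCommGroup E] [CompleteSpace E] (F : V → V → E)
    (hF : Summable fun p : OrientedEdge G => F p.1 p.2) :
    ∑' p : OrientedEdge G, F p.1 p.2 = ∑' v, ∑ u ∈ G.neighborFinset v, F v u := by
  rw [hF.tsum_sigma]
  refine tsum_congr fun v => ?_
  rw [tsum_fintype]
  exact Finset.sum_set_coe (f := F v) (G.neighborSet v)

theorem summable_sum_neighborFinset (G : SimpleGraph V) [DecidableRel G.Adj] [G.LocallyFinite]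
    {E : Type*} [NormedAddCommGroup E] [CompleteSpace E] (F : V → V → E)
    (hF : Summable fun p : OrientedEdge G => F p.1 p.2) :
    Summable fun v => ∑ u ∈ G.neighborFinset v, F v u := by
  refine hF.sigma.congr fun v => ?_
  rw [tsum_fintype]
  exact Finset.sum_set_coe (f := F v) (G.neighborSet v)

theorem summable_orientedEdge_fst (G : SimpleGraph V) [G.LocallyFinite] {D : ℕ}
    (hD : ∀ v, G.degree v ≤ D) {φ : V → ℝ} (hφ : Summable φ) (h0 : ∀ v, 0 ≤ φ v) :
    Summable fun p : OrientedEdge G => φ p.1 := by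
  rw [summable_sigma_of_nonneg fun p => h0 p.1]
  refine ⟨fun v => (hasSum_fintype _).summable, ?_⟩
  refine Summable.of_nonneg_of_le (fun v => tsum_nonneg fun _ => h0 v) (fun v => ?_)
    (hφ.mul_left (D : ℝ))
  change ∑' _ : G.neighborSet v, φ v ≤ D * φ v
  rw [tsum_fintype, Finset.sum_const, Finset.card_univ, SimpleGraph.card_neighborSet_eq_degree,
    nsmul_eq_mul]
  exact mul_le_mul_of_nonneg_right (by exact_mod_cast hD v) (h0 v)

theorem summable_orientedEdge_snd (G : SimpleGraph V) [G.LocallyFinite] {D : ℕ}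
    (hD : ∀ v, G.degree v ≤ D) {φ : V → ℝ} (hφ : Summable φ) (h0 : ∀ v, 0 ≤ φ v) :
    Summable fun p : OrientedEdge G => φ p.2 :=
  (OrientedEdge.swap G).summable_iff.mpr (summable_orientedEdge_fst G hD hφ h0)

theorem memℓp_two_iff_summable_sq {f : V → ℂ} : Memℓp f 2 ↔ Summable fun v => ‖f v‖ ^ 2 := by
  rw [memℓp_gen_iff (by norm_num)]
  norm_num

theorem l2norm_eq_norm (x : lp (fun _ : V => ℂ) 2) : l2norm (x : V → ℂ) = ‖x‖ := by
  rw [l2norm, lp.norm_eq_tsum_rpow (by norm_num), Real.sqrt_eq_rpow]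
  norm_num

theorem memℓp_lapl (G : SimpleGraph V) [DecidableRel G.Adj] [G.LocallyFinite] {D : ℕ}
    (hD : ∀ v, G.degree v ≤ D) {f : V → ℂ} (hf : Memℓp f 2) : Memℓp (lapl G f) 2 := by
  rw [memℓp_two_iff_summable_sq] at hf ⊢
  have h1 := summable_orientedEdge_fst G hD hf fun v => by positivity
  have h2 := summable_orientedEdge_snd G hD hf fun v => by positivity
  have hs := summable_sum_neighborFinset G (fun v u => 2 * (‖f v‖ ^ 2 + ‖f u‖ ^ 2))
    ((h1.add h2).mul_left 2)
  refine Summable.of_nonneg_of_le (fun v => by positivity) (fun v => ?_) (hs.mul_left (D : ℝ))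
  have hdeg : ((G.neighborFinset v).card : ℝ) ≤ D := by
    rw [SimpleGraph.card_neighborFinset_eq_degree]
    exact_mod_cast hD v
  calc ‖lapl G f v‖ ^ 2 ≤ (∑ u ∈ G.neighborFinset v, ‖f v - f u‖) ^ 2 := by
        gcongr
        exact norm_sum_le _ _
    _ ≤ (G.neighborFinset v).card * ∑ u ∈ G.neighborFinset v, ‖f v - f u‖ ^ 2 :=
        sq_sum_le_card_mul_sum_sq
    _ ≤ D * ∑ u ∈ G.neighborFinset v, 2 * (‖f v‖ ^ 2 + ‖f u‖ ^ 2) := by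
        gcongr with u _
        calc ‖f v - f u‖ ^ 2 ≤ (‖f v‖ + ‖f u‖) ^ 2 := by
              gcongr
              exact norm_sub_le _ _
          _ ≤ 2 * (‖f v‖ ^ 2 + ‖f u‖ ^ 2) := add_sq_le

/-- The Laplacian of a graph of bounded degree as a linear operator on `ℓ²`. -/
noncomputable def laplLp (G : SimpleGraph V) [DecidableRel G.Adj] [G.LocallyFinite] {D : ℕ}
    (hD : ∀ v, G.degree v ≤ D) : lp (fun _ : V => ℂ) 2 →ₗ[ℂ] lp (fun _ : V => ℂ) 2 where
  toFun x := ⟨lapl G x, memℓp_lapl G hD x.2⟩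
  map_add' x y := by
    ext v
    simp only [lapl, lp.coeFn_add, Pi.add_apply, ← Finset.sum_add_distrib]
    exact Finset.sum_congr rfl fun u _ => by ring
  map_smul' c x := by
    ext v
    simp only [lapl, lp.coeFn_smul, Pi.smul_apply, smul_eq_mul, RingHom.id_apply, Finset.mul_sum]
    exact Finset.sum_congr rfl fun u _ => by ring

theorem coe_laplLp_pow (G : SimpleGraph V) [DecidableRel G.Adj] [G.LocallyFinite] {D : ℕ}
    (hD : ∀ v, G.degree v ≤ D) (k : ℕ) (x : lp (fun _ : V => ℂ) 2) :
    (((laplLp G hD) ^ k) x : V → ℂ) = (lapl G)^[k] x := by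
  induction k with
  | zero => rfl
  | succ k ih =>
    rw [pow_succ', Function.iterate_succ_apply', ← ih]
    rfl

theorem summable_norm_sq (x : lp (fun _ : V => ℂ) 2) : Summable fun v => ‖x v‖ ^ 2 :=
  memℓp_two_iff_summable_sq.mp x.2

theorem summable_orientedEdge_mul_conj (G : SimpleGraph V) [G.LocallyFinite] {D : ℕ}
    (hD : ∀ v, G.degree v ≤ D) (x y : lp (fun _ : V => ℂ) 2) :
    Summable fun p : OrientedEdge G => x p.1 * conj (y p.2) := by
  have h1 := summable_orientedEdge_fst G hD (summable_norm_sq x) fun v => by positivity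
  have h2 := summable_orientedEdge_snd G hD (summable_norm_sq y) fun v => by positivity
  refine Summable.of_norm_bounded (h1.add h2) fun p => ?_
  rw [norm_mul, RCLike.norm_conj]
  nlinarith [sq_nonneg (‖x p.1‖ - ‖y p.2‖), sq_nonneg (‖x p.1‖ + ‖y p.2‖)]

theorem summable_orientedEdge_fst_mul_conj (G : SimpleGraph V) [G.LocallyFinite] {D : ℕ}
    (hD : ∀ v, G.degree v ≤ D) (x y : lp (fun _ : V => ℂ) 2) :
    Summable fun p : OrientedEdge G => x p.1 * conj (y p.1) := by
  have h1 := summable_orientedEdge_fst G hD (summable_norm_sq x) fun v => by positivity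
  have h2 := summable_orientedEdge_fst G hD (summable_norm_sq y) fun v => by positivity
  refine Summable.of_norm_bounded (h1.add h2) fun p => ?_
  rw [norm_mul, RCLike.norm_conj]
  nlinarith [sq_nonneg (‖x p.1‖ - ‖y p.1‖), sq_nonneg (‖x p.1‖ + ‖y p.1‖)]

theorem summable_orientedEdge_inner_laplLp (G : SimpleGraph V) [G.LocallyFinite] {D : ℕ}
    (hD : ∀ v, G.degree v ≤ D) (x y : lp (fun _ : V => ℂ) 2) :
    Summable fun p : OrientedEdge G => y p.1 * conj (x p.1 - x p.2) :=
  ((summable_orientedEdge_fst_mul_conj G hD y x).sub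
    (summable_orientedEdge_mul_conj G hD y x)).congr fun p => by rw [map_sub, mul_sub]

theorem inner_laplLp_left (G : SimpleGraph V) [DecidableRel G.Adj] [G.LocallyFinite] {D : ℕ}
    (hD : ∀ v, G.degree v ≤ D) (x y : lp (fun _ : V => ℂ) 2) :
    ⟪laplLp G hD x, y⟫_ℂ = ∑' p : OrientedEdge G, y p.1 * conj (x p.1 - x p.2) := by
  rw [lp.inner_eq_tsum, tsum_orientedEdge G (fun v u => y v * conj (x v - x u))
    (summable_orientedEdge_inner_laplLp G hD x y)]
  refine tsum_congr fun v => ?_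
  rw [RCLike.inner_apply, ← Finset.mul_sum, ← map_sum]
  rfl

theorem laplLp_isSymmetric (G : SimpleGraph V) [DecidableRel G.Adj] [G.LocallyFinite] {D : ℕ}
    (hD : ∀ v, G.degree v ≤ D) : (laplLp G hD).IsSymmetric := by
  intro x y
  have hsum : ∀ x y : lp (fun _ : V => ℂ) 2, ⟪laplLp G hD x, y⟫_ℂ =
      ∑' p : OrientedEdge G, y p.1 * conj (x p.1)
        - ∑' p : OrientedEdge G, y p.1 * conj (x p.2) := fun x y => by
    rw [inner_laplLp_left, ← (summable_orientedEdge_fst_mul_conj G hD y x).tsum_sub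
      (summable_orientedEdge_mul_conj G hD y x)]
    exact tsum_congr fun p => by rw [map_sub, mul_sub]
  rw [← inner_conj_symm x, hsum x y, hsum y x, map_sub, Complex.conj_tsum, Complex.conj_tsum,
    ← (OrientedEdge.swap G).tsum_eq fun p => conj (x p.1 * conj (y p.2))]
  congr 1 <;> refine tsum_congr fun p => ?_ <;>
    simp [OrientedEdge.swap, mul_comm]

/-- For a function vanishing on `S`, the Dirichlet form is at least `K ‖x‖ ^ 2` when every vertex
outside `S` has at least `K` neighbours in `S`. -/
theorem mul_norm_sq_le_re_inner_laplLp (G : SimpleGraph V) [DecidableRel G.Adj]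
    [G.LocallyFinite] {D : ℕ} (hD : ∀ v, G.degree v ≤ D) {S : Set V} {K : ℕ}
    (hK : ∀ v ∉ S, K ≤ {u | u ∈ S ∧ G.Adj v u}.ncard) {x : lp (fun _ : V => ℂ) 2}
    (hx : ∀ v ∈ S, x v = 0) :
    K * ‖x‖ ^ 2 ≤ (⟪laplLp G hD x, x⟫_ℂ).re := by
  classical
  have hφ := summable_norm_sq x
  have h1 := summable_orientedEdge_fst G hD hφ fun v => by positivity
  have h2 := summable_orientedEdge_snd G hD hφ fun v => by positivity
  let ψ : V → V → ℝ := fun v u => if u ∈ S then ‖x v‖ ^ 2 else 0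
  have hψ : Summable fun p : OrientedEdge G => ψ p.1 p.2 := by
    refine Summable.of_nonneg_of_le (fun p => ?_) (fun p => ?_) h1 <;>
      simp only [ψ] <;> split_ifs <;> first | positivity | exact le_rfl
  have hψ' : Summable fun p : OrientedEdge G => ψ p.2 p.1 :=
    (OrientedEdge.swap G).summable_iff.mpr hψ
  have hnorm : ‖x‖ ^ 2 = ∑' v, ‖x v‖ ^ 2 := by
    rw [← l2norm_eq_norm, l2norm, Real.sq_sqrt (tsum_nonneg fun v => by positivity)]
  have hS := summable_orientedEdge_inner_laplLp G hD x x
  have hlow : K * ‖x‖ ^ 2 ≤ ∑' p : OrientedEdge G, ψ p.1 p.2 := by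
    rw [hnorm, ← tsum_mul_left, tsum_orientedEdge G ψ hψ]
    refine (hφ.mul_left _).tsum_le_tsum (fun v => ?_) (summable_sum_neighborFinset G ψ hψ)
    by_cases hv : v ∈ S
    · rw [hx v hv]
      simp [ψ, hx v hv]
    · simp only [ψ]
      rw [← Finset.sum_filter, Finset.sum_const, nsmul_eq_mul]
      gcongr
      refine (hK v hv).trans (le_of_eq ?_)
      rw [← Set.ncard_coe_finset]
      congr 1
      ext u
      simp [and_comm]
  have hswapψ : ∑' p : OrientedEdge G, ψ p.2 p.1 = ∑' p : OrientedEdge G, ψ p.1 p.2 :=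
    (OrientedEdge.swap G).tsum_eq fun p => ψ p.1 p.2
  have hswap : ∑' p : OrientedEdge G, ‖x p.2‖ ^ 2 = ∑' p : OrientedEdge G, ‖x p.1‖ ^ 2 :=
    (OrientedEdge.swap G).tsum_eq fun p => ‖x p.1‖ ^ 2
  have hre : (⟪laplLp G hD x, x⟫_ℂ).re =
      ∑' p : OrientedEdge G, (x p.1 * conj (x p.1 - x p.2)).re := by
    rw [inner_laplLp_left, Complex.re_tsum hS]
  have hle : ∑' p : OrientedEdge G,
      ((‖x p.1‖ ^ 2 - ‖x p.2‖ ^ 2) + (ψ p.1 p.2 + ψ p.2 p.1)) ≤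
      ∑' p : OrientedEdge G, 2 * (x p.1 * conj (x p.1 - x p.2)).re := by
    refine ((h1.sub h2).add (hψ.add hψ')).tsum_le_tsum (fun p => ?_)
      ((Complex.hasSum_re hS.hasSum).summable.mul_left 2)
    have hsq : ∀ z : ℂ, ‖z‖ ^ 2 = z.re ^ 2 + z.im ^ 2 := fun z => by
      rw [← Complex.normSq_eq_norm_sq, Complex.normSq_apply]
      ring
    by_cases hv : p.1 ∈ S <;> by_cases hu : (p.2 : V) ∈ S
    · simp [ψ, hv, hu, hx _ hv, hx _ hu]
    · simp [ψ, hv, hu, hx _ hv]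
    · simp [ψ, hv, hu, hx _ hu, hsq]
      nlinarith
    · simp [ψ, hv, hu, hsq]
      nlinarith [sq_nonneg ((x p.1).re - (x p.2).re), sq_nonneg ((x p.1).im - (x p.2).im)]
  rw [(h1.sub h2).tsum_add (hψ.add hψ'), h1.tsum_sub h2, hψ.tsum_add hψ', hswap, hswapψ,
    tsum_mul_left, ← hre] at hle
  linarith

/-- A symmetric operator whose powers grow at most like `ω ^ k` on a vector satisfies the
Bernstein inequality on that vector. -/
theorem LinearMap.IsSymmetric.norm_apply_le_of_norm_pow_le {E : Type*} [NormedAddCommGroup E]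
    [InnerProductSpace ℂ E] {T : E →ₗ[ℂ] E} (hT : T.IsSymmetric) {ω C : ℝ} (hω : 0 < ω) {x : E}
    (hx : ∀ k : ℕ, ‖(T ^ k) x‖ ≤ ω ^ k * C) : ‖T x‖ ≤ ω * ‖x‖ := by
  by_contra! hlt
  have hx0 : 0 < ‖x‖ := by
    rw [norm_pos_iff]
    rintro rfl
    simp at hlt
  have hconv : ∀ y : E, ‖T y‖ ^ 2 ≤ ‖y‖ * ‖T (T y)‖ := fun y => by
    rw [← inner_self_eq_norm_sq (𝕜 := ℂ) (T y), hT y (T y)]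
    exact (RCLike.re_le_norm _).trans (norm_inner_le_norm _ _)
  obtain ⟨r, hr⟩ : ∃ r, r = ‖T x‖ / ‖x‖ := ⟨_, rfl⟩
  have hrω : ω < r := by rwa [hr, lt_div_iff₀ hx0]
  have hr0 : 0 < r := hω.trans hrω
  have hgrow : ∀ k : ℕ, 0 < ‖(T ^ k) x‖ ∧ r * ‖(T ^ k) x‖ ≤ ‖(T ^ (k + 1)) x‖ := by
    intro k
    induction k with
    | zero =>
      simp only [pow_zero, zero_add, pow_one, Module.End.one_apply]
      exact ⟨hx0, by rw [hr, div_mul_cancel₀ _ hx0.ne']⟩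
    | succ k ih =>
      obtain ⟨hpos, hle⟩ := ih
      have hpos' : 0 < ‖(T ^ (k + 1)) x‖ := (mul_pos hr0 hpos).trans_le hle
      refine ⟨hpos', ?_⟩
      have h := hconv ((T ^ k) x)
      rw [← Module.End.mul_apply, ← pow_succ', ← Module.End.mul_apply, ← pow_succ'] at h
      refine le_of_mul_le_mul_left ?_ hpos
      nlinarith
  have hpow : ∀ k : ℕ, r ^ k * ‖x‖ ≤ ‖(T ^ k) x‖ := by
    intro k
    induction k with
    | zero => simp
    | succ k ih =>
      calc r ^ (k + 1) * ‖x‖ = r * (r ^ k * ‖x‖) := by ring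
        _ ≤ r * ‖(T ^ k) x‖ := by gcongr
        _ ≤ _ := (hgrow k).2
  obtain ⟨n, hn⟩ := pow_unbounded_of_one_lt (C / ‖x‖) ((one_lt_div hω).mpr hrω)
  rw [div_pow, div_lt_div_iff₀ hx0 (pow_pos hω n)] at hn
  linarith [hpow n, hx n]

theorem stmt11 [Countable V] (G : SimpleGraph V) [DecidableRel G.Adj] [G.LocallyFinite]
    (hconn : G.Connected) (D : ℕ) (hD : ∀ v, G.degree v ≤ D)
    (S : Set V) (K₀ : ℕ) (hK : 1 ≤ K₀)
    (hKS : ∀ v ∈ bdry G S, K₀ ≤ {u | u ∈ S ∧ G.Adj v u}.ncard)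
    (hcover : S ∪ bdry G S = Set.univ)
    (ω : ℝ) (hω : 0 < ω) (hωsmall : ω < (K₀ : ℝ) / 4)
    (f g : V → ℂ) (hf : f ∈ PW G ω) (hg : g ∈ PW G ω)
    (hfg : ∀ u ∈ S, f u = g u) :
    f = g := by
  obtain ⟨hf2, hfω⟩ := hf
  obtain ⟨hg2, hgω⟩ := hg
  let x : lp (fun _ : V => ℂ) 2 := ⟨f, hf2⟩
  let y : lp (fun _ : V => ℂ) 2 := ⟨g, hg2⟩
  have hbern : ‖laplLp G hD (x - y)‖ ≤ ω * ‖x - y‖ := by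
    refine (laplLp_isSymmetric G hD).norm_apply_le_of_norm_pow_le hω
      (C := l2norm f + l2norm g) fun k => ?_
    rw [map_sub, mul_add]
    refine (norm_sub_le _ _).trans (add_le_add ?_ ?_) <;> rw [← l2norm_eq_norm, coe_laplLp_pow]
    exacts [hfω k, hgω k]
  have hlow : K₀ * ‖x - y‖ ^ 2 ≤ (⟪laplLp G hD (x - y), x - y⟫_ℂ).re := by
    refine mul_norm_sq_le_re_inner_laplLp G hD (S := S) (fun v hv => hKS v ?_) fun v hv => ?_
    · exact (hcover.ge (Set.mem_univ v)).resolve_left hv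
    · exact sub_eq_zero.mpr (hfg v hv)
  have hup : (⟪laplLp G hD (x - y), x - y⟫_ℂ).re ≤ ω * ‖x - y‖ * ‖x - y‖ :=
    ((Complex.re_le_norm _).trans (norm_inner_le_norm _ _)).trans (by gcongr)
  have hzero : ‖x - y‖ = 0 := by
    by_contra h
    have hpos : 0 < ‖x - y‖ ^ 2 := by positivity
    nlinarith
  exact congrArg Subtype.val (sub_eq_zero.mp (norm_eq_zero.mp hzero))
end
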